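/- arXiv:2605.06521 — 3 statements merged into one kernel-verified Lean document; each statement's English description precedes it below -/
import Mathlib

section
/- Suppose a⋆ ∈ 𝒜 and η⋆ ∈ (0,1) satisfy sup_{a∈𝒜} 𝔼_{π₁}[φ(a,·)^{η⋆}] = 𝔼_{π₁}[φ(a⋆,·)^{η⋆}] = e^{1/T}, and that φ(a⋆,·) ≤ Φ π₁-almost surely for some constant Φ. Then, writing τ^{a⋆} for the rejection time of the constant policy always playing a⋆, one has (α/Φ)^{η⋆} ≤ 𝔼_{π₁^⊗}[e^{-τ^{a⋆}/T}] ≤ sup over Markov policies a^∞ of 𝔼_{π₁^⊗}[e^{-τ^{a^∞}/T}] ≤ α^{η⋆}. -/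
open MeasureTheory ProbabilityTheory ENNReal NNReal Set Filter

attribute [local instance] Classical.propDecidable

noncomputable section

variable {𝒳 𝒜 : Type*} [MeasurableSpace 𝒳] [MeasurableSpace 𝒜]

/-- `P` is the law of an i.i.d. sequence of draws from `π`: the infinite product measure
`π^⊗` on the path space `𝒳^∞`, characterized through its finite-dimensional marginals. -/
def IsIIDProduct {𝒳 : Type*} [MeasurableSpace 𝒳] (π : Measure 𝒳)
    (P : Measure (ℕ → 𝒳)) : Prop :=
  IsProbabilityMeasure P ∧
    ∀ n : ℕ, P.map (fun x (i : Fin n) => x i.val) = Measure.pi (fun _ : Fin n => π)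

/-- Wealth process of a Markov policy `a`, where `a n` is the action chosen at round `n+1`
as a Borel function of the current wealth `w ∈ [0, α⁻¹)`.  Once the wealth leaves
`[0, α⁻¹)` (the rejection threshold has been reached) the process is frozen: the choice of
action is then irrelevant. -/
def mkvWealth (φ : 𝒜 → 𝒳 → ℝ≥0) (α : ℝ≥0)
    (a : (n : ℕ) → (Set.Ico (0 : ℝ≥0) α⁻¹) → 𝒜) : ℕ → (ℕ → 𝒳) → ℝ≥0
  | 0, _ => 1
  | n + 1, x =>
      if h : mkvWealth φ α a n x ∈ Set.Ico (0 : ℝ≥0) α⁻¹ then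
        mkvWealth φ α a n x * φ (a n ⟨mkvWealth φ α a n x, h⟩) (x n)
      else mkvWealth φ α a n x

/-- Rejection time of a Markov policy. -/
def mkvRejTime (φ : 𝒜 → 𝒳 → ℝ≥0) (α : ℝ≥0)
    (a : (n : ℕ) → (Set.Ico (0 : ℝ≥0) α⁻¹) → 𝒜) (x : ℕ → 𝒳) : ℕ∞ :=
  ⨅ (t : ℕ) (_ : 1 ≤ t ∧ α⁻¹ ≤ mkvWealth φ α a t x), (t : ℕ∞)

/-- Wealth of the constant policy that always plays the action `a`. -/
def constWealth (φ : 𝒜 → 𝒳 → ℝ≥0) (a : 𝒜) : ℕ → (ℕ → 𝒳) → ℝ≥0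
  | 0, _ => 1
  | n + 1, x => constWealth φ a n x * φ a (x n)

/-- Rejection time of the constant policy playing `a`. -/
def constRejTime (φ : 𝒜 → 𝒳 → ℝ≥0) (α : ℝ≥0) (a : 𝒜) (x : ℕ → 𝒳) : ℕ∞ :=
  ⨅ (t : ℕ) (_ : 1 ≤ t ∧ α⁻¹ ≤ constWealth φ a t x), (t : ℕ∞)

/-- The exponentially decaying reward `e^{-t/T}` evaluated at a (possibly infinite)
rejection time, with the convention `e^{-∞/T} = 0`. -/
def expReward (T : ℝ) (n : ℕ∞) : ℝ≥0∞ :=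
  if n = ⊤ then 0 else ENNReal.ofReal (Real.exp (-(n.toNat : ℝ) / T))

section IIDProduct

variable {π : Measure 𝒳} {P : Measure (ℕ → 𝒳)}

/-- Under the i.i.d. law, the first `n` coordinates are independent of coordinate `n`. -/
theorem IsIIDProduct.map_prefix_prod [IsProbabilityMeasure π] (hP : IsIIDProduct π P) (n : ℕ) :
    P.map (fun x => (x n, fun i : Fin n => x i.val)) =
      π.prod (Measure.pi fun _ : Fin n => π) := by
  have h := (measurePreserving_piFinSuccAbove (fun _ : Fin (n + 1) => π) (Fin.last n)).map_eq
  rw [← hP.2 (n + 1), Measure.map_map (MeasurableEquiv.measurable _) (by fun_prop)] at h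
  rw [← h]
  congr 1
  funext x
  simp [MeasurableEquiv.piFinSuccAbove, Fin.insertNthEquiv, Fin.init_def]

/-- A functional of the first `n` coordinates is independent of coordinate `n`, which has
law `π`. -/
theorem IsIIDProduct.lintegral_adapted [IsProbabilityMeasure π] (hP : IsIIDProduct π P)
    {E : Type*} [MeasurableSpace E] (n : ℕ) {G : (ℕ → 𝒳) → E} (hG : Measurable G)
    (hadapted : ∀ x y : ℕ → 𝒳, (∀ i < n, x i = y i) → G x = G y)
    {F : E × 𝒳 → ℝ≥0∞} (hF : Measurable F) :
    ∫⁻ x, F (G x, x n) ∂P = ∫⁻ x, ∫⁻ z, F (G x, z) ∂π ∂P := by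
  have := hP.1
  obtain ⟨z₀⟩ : Nonempty 𝒳 := π.nonempty_of_neZero
  let ext : (Fin n → 𝒳) → ℕ → 𝒳 := fun y i => if h : i < n then y ⟨i, h⟩ else z₀
  have hext : Measurable ext := by
    refine measurable_pi_iff.2 fun i => ?_
    by_cases h : i < n
    · simpa [ext, h] using measurable_pi_apply _
    · simp [ext, h]
  have hGext : ∀ x, G x = G (ext fun i => x i.val) := fun x =>
    hadapted _ _ fun i hi => by simp [ext, hi]
  have hm : Measurable fun p : 𝒳 × (Fin n → 𝒳) => F (G (ext p.2), p.1) := by fun_prop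
  have hm' : Measurable fun y : Fin n → 𝒳 => ∫⁻ z, F (G (ext y), z) ∂π :=
    Measurable.lintegral_prod_left' (f := fun p : 𝒳 × (Fin n → 𝒳) => F (G (ext p.2), p.1)) hm
  calc ∫⁻ x, F (G x, x n) ∂P
      = ∫⁻ x, (fun p : 𝒳 × (Fin n → 𝒳) => F (G (ext p.2), p.1))
          (x n, fun i : Fin n => x i.val) ∂P := by
        refine lintegral_congr fun x => ?_
        rw [hGext x]
    _ = ∫⁻ p, F (G (ext p.2), p.1) ∂(π.prod (Measure.pi fun _ : Fin n => π)) := by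
        rw [← hP.map_prefix_prod n, lintegral_map hm (by fun_prop)]
    _ = ∫⁻ y, ∫⁻ z, F (G (ext y), z) ∂π ∂(Measure.pi fun _ : Fin n => π) :=
        lintegral_prod_symm _ hm.aemeasurable
    _ = ∫⁻ x, ∫⁻ z, F (G x, z) ∂π ∂P := by
        rw [← hP.2 n, lintegral_map hm' (by fun_prop)]
        refine lintegral_congr fun x => ?_
        rw [← hGext x]

theorem IsIIDProduct.map_eval [IsProbabilityMeasure π] (hP : IsIIDProduct π P) (n : ℕ) :
    P.map (fun x => x n) = π := by
  have h := congrArg Measure.fst (hP.map_prefix_prod n)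
  rwa [Measure.fst_prod, Measure.fst, Measure.map_map measurable_fst (by fun_prop)] at h

end IIDProduct

section Wealth

variable {𝒳 𝒜 : Type*} {φ : 𝒜 → 𝒳 → ℝ≥0} {α : ℝ≥0}
  {a : (n : ℕ) → (Set.Ico (0 : ℝ≥0) α⁻¹) → 𝒜}

/-- The discount factor `d ^ min n τ` accumulated by a Markov policy up to round `n`. -/
def mkvDiscount (φ : 𝒜 → 𝒳 → ℝ≥0) (α : ℝ≥0)
    (a : (n : ℕ) → (Set.Ico (0 : ℝ≥0) α⁻¹) → 𝒜) (d : ℝ≥0∞) : ℕ → (ℕ → 𝒳) → ℝ≥0∞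
  | 0, _ => 1
  | n + 1, x =>
      if mkvWealth φ α a n x ∈ Set.Ico (0 : ℝ≥0) α⁻¹ then mkvDiscount φ α a d n x * d
      else mkvDiscount φ α a d n x

theorem mkvWealth_adapted (n : ℕ) {x y : ℕ → 𝒳} (hxy : ∀ i < n, x i = y i) :
    mkvWealth φ α a n x = mkvWealth φ α a n y := by
  induction n with
  | zero => rfl
  | succ n ih =>
    have h := ih fun i hi => hxy i (hi.trans n.lt_succ_self)
    simp only [mkvWealth, h, hxy n n.lt_succ_self]

theorem mkvDiscount_adapted {d : ℝ≥0∞} (n : ℕ) {x y : ℕ → 𝒳} (hxy : ∀ i < n, x i = y i) :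
    mkvDiscount φ α a d n x = mkvDiscount φ α a d n y := by
  induction n with
  | zero => rfl
  | succ n ih =>
    have hlt : ∀ i < n, x i = y i := fun i hi => hxy i (hi.trans n.lt_succ_self)
    simp only [mkvDiscount, ih hlt, mkvWealth_adapted n hlt]

/-- The growth factor of the wealth in one round, frozen to `1` after rejection. -/
def mkvFactor (φ : 𝒜 → 𝒳 → ℝ≥0) (α : ℝ≥0) (b : (Set.Ico (0 : ℝ≥0) α⁻¹) → 𝒜)
    (p : ℝ≥0 × 𝒳) : ℝ≥0 :=
  if h : p.1 ∈ Set.Ico (0 : ℝ≥0) α⁻¹ then φ (b ⟨p.1, h⟩) p.2 else 1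

theorem mkvWealth_succ (n : ℕ) (x : ℕ → 𝒳) :
    mkvWealth φ α a (n + 1) x =
      mkvWealth φ α a n x * mkvFactor φ α (a n) (mkvWealth φ α a n x, x n) := by
  rw [mkvWealth, mkvFactor]
  split_ifs <;> simp

/-- Either the threshold has not been reached by round `n`, or the process is frozen since the
rejection time. -/
theorem mkvWealth_dichotomy (hα1 : 1 < α⁻¹) (d : ℝ≥0∞) (x : ℕ → 𝒳) (n : ℕ) :
    ((∀ k ≤ n, mkvWealth φ α a k x < α⁻¹) ∧ mkvDiscount φ α a d n x = d ^ n) ∨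
    (α⁻¹ ≤ mkvWealth φ α a n x ∧
      ∃ k : ℕ, mkvRejTime φ α a x = k ∧ mkvDiscount φ α a d n x = d ^ k) := by
  induction n with
  | zero => exact Or.inl ⟨by simpa [mkvWealth] using hα1, by simp [mkvDiscount]⟩
  | succ n ih =>
    rcases ih with ⟨hlt, hdisc⟩ | ⟨hge, hk⟩
    · have hmem : mkvWealth φ α a n x ∈ Set.Ico (0 : ℝ≥0) α⁻¹ := ⟨zero_le, hlt n le_rfl⟩
      have hdisc' : mkvDiscount φ α a d (n + 1) x = d ^ (n + 1) := by
        rw [mkvDiscount, if_pos hmem, hdisc, pow_succ]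
      rcases lt_or_ge (mkvWealth φ α a (n + 1) x) α⁻¹ with h | h
      · refine Or.inl ⟨fun k hk => ?_, hdisc'⟩
        rcases Nat.le_succ_iff.1 hk with hk | rfl
        exacts [hlt k hk, h]
      · refine Or.inr ⟨h, n + 1, le_antisymm ?_ ?_, hdisc'⟩
        · exact iInf₂_le (n + 1) ⟨Nat.le_add_left 1 n, h⟩
        · refine le_iInf₂ fun t ht => Nat.cast_le.2 ?_
          by_contra! hcon
          exact (hlt t (Nat.lt_succ_iff.1 hcon)).not_ge ht.2
    · have hmem : mkvWealth φ α a n x ∉ Set.Ico (0 : ℝ≥0) α⁻¹ := fun h => h.2.not_ge hge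
      refine Or.inr ?_
      rw [mkvWealth, dif_neg hmem, mkvDiscount, if_neg hmem]
      exact ⟨hge, hk⟩

/-- Bounded growth factors bound the overshoot of the stopped wealth. -/
theorem mkvWealth_const_le {b : 𝒜} {Φ : ℝ≥0} {x : ℕ → 𝒳} (hΦ : ∀ n, φ b (x n) ≤ Φ) (n : ℕ)
    (hα1 : 1 < α⁻¹) (h : α⁻¹ ≤ mkvWealth φ α (fun _ _ => b) n x) :
    mkvWealth φ α (fun _ _ => b) n x ≤ α⁻¹ * Φ := by
  induction n with
  | zero => exact absurd h (by simpa [mkvWealth] using hα1)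
  | succ n ih =>
    rw [mkvWealth] at h ⊢
    split_ifs at h ⊢ with hmem
    · exact mul_le_mul' hmem.2.le (hΦ n)
    · exact ih h

theorem mkvRejTime_const (hα1 : 1 < α⁻¹) (b : 𝒜) (x : ℕ → 𝒳) :
    mkvRejTime φ α (fun _ _ => b) x = constRejTime φ α b x := by
  have key : ∀ n, (mkvWealth φ α (fun _ _ => b) n x = constWealth φ b n x ∧
        constWealth φ b n x < α⁻¹) ∨
      ∃ k ≤ n, (1 ≤ k ∧ α⁻¹ ≤ mkvWealth φ α (fun _ _ => b) k x) ∧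
        α⁻¹ ≤ constWealth φ b k x := by
    intro n
    induction n with
    | zero => exact Or.inl ⟨rfl, by simpa [constWealth] using hα1⟩
    | succ n ih =>
      rcases ih with ⟨heq, hlt⟩ | ⟨k, hk, h⟩
      · have heq' : mkvWealth φ α (fun _ _ => b) (n + 1) x = constWealth φ b (n + 1) x := by
          rw [mkvWealth, dif_pos ⟨zero_le, heq ▸ hlt⟩, constWealth, heq]
        rcases lt_or_ge (constWealth φ b (n + 1) x) α⁻¹ with h | h
        · exact Or.inl ⟨heq', h⟩
        · exact Or.inr ⟨n + 1, le_rfl, ⟨Nat.le_add_left 1 n, heq' ▸ h⟩, h⟩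
      · exact Or.inr ⟨k, hk.trans n.le_succ, h⟩
  refine le_antisymm (le_iInf₂ fun t ht => ?_) (le_iInf₂ fun t ht => ?_)
  · rcases key t with ⟨-, hlt⟩ | ⟨k, hk, h, -⟩
    · exact absurd ht.2 hlt.not_ge
    · exact (iInf₂_le k h).trans (Nat.cast_le.2 hk)
  · rcases key t with ⟨heq, hlt⟩ | ⟨k, hk, h, h'⟩
    · exact absurd ht.2 (heq ▸ hlt).not_ge
    · exact (iInf₂_le k ⟨h.1, h'⟩).trans (Nat.cast_le.2 hk)

end Wealth

section DiscountedWealth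

variable {φ : 𝒜 → 𝒳 → ℝ≥0} {α : ℝ≥0} {a : (n : ℕ) → (Set.Ico (0 : ℝ≥0) α⁻¹) → 𝒜}

theorem measurable_mkvFactor (hφ : Measurable fun p : 𝒜 × 𝒳 => φ p.1 p.2)
    {b : (Set.Ico (0 : ℝ≥0) α⁻¹) → 𝒜} (hb : Measurable b) : Measurable (mkvFactor φ α b) := by
  have hs : MeasurableSet (Prod.fst ⁻¹' Set.Ico (0 : ℝ≥0) α⁻¹ : Set (ℝ≥0 × 𝒳)) :=
    measurable_fst measurableSet_Ico
  refine measurable_of_restrict_of_restrict_compl hs ?_ ?_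
  · have hfst : Measurable fun p : ↥(Prod.fst ⁻¹' Set.Ico (0 : ℝ≥0) α⁻¹ : Set (ℝ≥0 × 𝒳)) =>
        (⟨p.1.1, p.2⟩ : Set.Ico (0 : ℝ≥0) α⁻¹) :=
      (measurable_fst.comp measurable_subtype_coe).subtype_mk
    convert hφ.comp ((hb.comp hfst).prodMk (measurable_snd.comp measurable_subtype_coe)) using 1
    exact funext fun p => dif_pos (c := p.1.1 ∈ Set.Ico (0 : ℝ≥0) α⁻¹) p.2
  · convert measurable_const (a := (1 : ℝ≥0)) using 1
    exact funext fun p => dif_neg (c := p.1.1 ∈ Set.Ico (0 : ℝ≥0) α⁻¹) p.2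

theorem measurable_mkvWealth (hφ : Measurable fun p : 𝒜 × 𝒳 => φ p.1 p.2)
    (ha : ∀ n, Measurable (a n)) (n : ℕ) : Measurable (mkvWealth φ α a n) := by
  induction n with
  | zero => exact measurable_const
  | succ n ih =>
    rw [funext (mkvWealth_succ n)]
    exact ih.mul ((measurable_mkvFactor hφ (ha n)).comp (ih.prodMk (measurable_pi_apply n)))

theorem measurable_mkvDiscount (hφ : Measurable fun p : 𝒜 × 𝒳 => φ p.1 p.2)
    (ha : ∀ n, Measurable (a n)) (d : ℝ≥0∞) (n : ℕ) :
    Measurable (mkvDiscount φ α a d n) := by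
  induction n with
  | zero => exact measurable_const
  | succ n ih =>
    exact Measurable.ite (measurable_mkvWealth hφ ha n measurableSet_Ico) (ih.mul_const d) ih

/-- One step of the discounted power wealth, with the last observation integrated out. -/
theorem lintegral_mkvDiscount_mul_rpow_succ (hφ : Measurable fun p : 𝒜 × 𝒳 => φ p.1 p.2)
    (ha : ∀ n, Measurable (a n)) {π : Measure 𝒳} [IsProbabilityMeasure π]
    {P : Measure (ℕ → 𝒳)} (hP : IsIIDProduct π P) (d : ℝ≥0∞) {η : ℝ} (hη : 0 ≤ η) (n : ℕ) :
    ∫⁻ x, mkvDiscount φ α a d (n + 1) x * (mkvWealth φ α a (n + 1) x : ℝ≥0∞) ^ η ∂P =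
      ∫⁻ x, mkvDiscount φ α a d n x * (mkvWealth φ α a n x : ℝ≥0∞) ^ η *
        (if h : mkvWealth φ α a n x ∈ Set.Ico (0 : ℝ≥0) α⁻¹ then
          d * ∫⁻ z, (φ (a n ⟨mkvWealth φ α a n x, h⟩) z : ℝ≥0∞) ^ η ∂π else 1) ∂P := by
  let G : (ℕ → 𝒳) → ℝ≥0 × ℝ≥0∞ := fun x => (mkvWealth φ α a n x, mkvDiscount φ α a d n x)
  let c : ℝ≥0 → ℝ≥0∞ := fun w => if w ∈ Set.Ico (0 : ℝ≥0) α⁻¹ then d else 1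
  have hc : Measurable c := Measurable.ite measurableSet_Ico measurable_const measurable_const
  let F : (ℝ≥0 × ℝ≥0∞) × 𝒳 → ℝ≥0∞ := fun p =>
    p.1.2 * (p.1.1 : ℝ≥0∞) ^ η *
      (c p.1.1 * (mkvFactor φ α (a n) (p.1.1, p.2) : ℝ≥0∞) ^ η)
  have hfac := measurable_mkvFactor hφ (ha n)
  have hF : Measurable F := by fun_prop
  have hG : Measurable G :=
    (measurable_mkvWealth hφ ha n).prodMk (measurable_mkvDiscount hφ ha d n)
  calc _ = ∫⁻ x, F (G x, x n) ∂P := by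
        refine lintegral_congr fun x => ?_
        simp only [F, G, c, mkvWealth_succ n x, mkvDiscount, ENNReal.coe_mul,
          ENNReal.mul_rpow_of_nonneg _ _ hη]
        split_ifs <;> ring
    _ = ∫⁻ x, ∫⁻ z, F (G x, z) ∂π ∂P :=
        hP.lintegral_adapted n hG
          (fun x y hxy => Prod.ext (mkvWealth_adapted n hxy) (mkvDiscount_adapted n hxy)) hF
    _ = _ := by
        refine lintegral_congr fun x => ?_
        have hm : Measurable fun z =>
            (mkvFactor φ α (a n) (mkvWealth φ α a n x, z) : ℝ≥0∞) ^ η := by fun_prop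
        simp only [F, G]
        rw [lintegral_const_mul _ (by fun_prop), lintegral_const_mul _ hm]
        congr 1
        by_cases h : mkvWealth φ α a n x ∈ Set.Ico (0 : ℝ≥0) α⁻¹
        · simp only [c, mkvFactor, h, if_true, dif_pos]
        · simp only [c, mkvFactor, h, if_false, dif_neg, not_false_eq_true]
          simp

/-- The discounted power wealth is a supermartingale in mean. -/
theorem lintegral_mkvDiscount_mul_rpow_le_one (hφ : Measurable fun p : 𝒜 × 𝒳 => φ p.1 p.2)
    (ha : ∀ n, Measurable (a n)) {π : Measure 𝒳} [IsProbabilityMeasure π]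
    {P : Measure (ℕ → 𝒳)} (hP : IsIIDProduct π P) {d : ℝ≥0∞} {η : ℝ} (hη : 0 ≤ η)
    (hd : ∀ b, d * ∫⁻ z, (φ b z : ℝ≥0∞) ^ η ∂π ≤ 1) (n : ℕ) :
    ∫⁻ x, mkvDiscount φ α a d n x * (mkvWealth φ α a n x : ℝ≥0∞) ^ η ∂P ≤ 1 := by
  have := hP.1
  induction n with
  | zero => simp [mkvDiscount, mkvWealth]
  | succ n ih =>
    rw [lintegral_mkvDiscount_mul_rpow_succ hφ ha hP d hη n]
    refine (lintegral_mono fun x => mul_le_of_le_one_right' ?_).trans ih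
    split_ifs with h
    exacts [hd _, le_rfl]

/-- For a constant policy at the critical discount, the discounted power wealth has mean one. -/
theorem lintegral_mkvDiscount_mul_rpow_eq_one (hφ : Measurable fun p : 𝒜 × 𝒳 => φ p.1 p.2)
    {π : Measure 𝒳} [IsProbabilityMeasure π]
    {P : Measure (ℕ → 𝒳)} (hP : IsIIDProduct π P) {d : ℝ≥0∞} {η : ℝ} (hη : 0 ≤ η) {b : 𝒜}
    (hd : d * ∫⁻ z, (φ b z : ℝ≥0∞) ^ η ∂π = 1) (n : ℕ) :
    ∫⁻ x, mkvDiscount φ α (fun _ _ => b) d n x *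
      (mkvWealth φ α (fun _ _ => b) n x : ℝ≥0∞) ^ η ∂P = 1 := by
  have := hP.1
  induction n with
  | zero => simp [mkvDiscount, mkvWealth]
  | succ n ih =>
    rw [lintegral_mkvDiscount_mul_rpow_succ hφ (fun _ => measurable_const) hP d hη n]
    simpa [hd] using ih

end DiscountedWealth

theorem expReward_natCast (T : ℝ) (k : ℕ) :
    expReward T k = ENNReal.ofReal (Real.exp (-1 / T)) ^ k := by
  rw [expReward, if_neg (ENat.natCast_ne_top k), ← ENNReal.ofReal_pow (Real.exp_pos _).le,
    ← Real.exp_nat_mul, ENat.toNat_natCast]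
  congr 2
  ring

theorem expReward_le_pow {T : ℝ} (hT : 0 < T) {m : ℕ∞} {n : ℕ} (h : (n : ℕ∞) ≤ m) :
    expReward T m ≤ ENNReal.ofReal (Real.exp (-1 / T)) ^ n := by
  induction m using ENat.recTopCoe with
  | top => simp [expReward]
  | coe k =>
    rw [expReward_natCast]
    refine pow_le_pow_right_of_le_one' ?_ (Nat.cast_le.1 h)
    rw [ENNReal.ofReal_le_one, Real.exp_le_one_iff]
    exact div_nonpos_of_nonpos_of_nonneg (by norm_num) hT.le

theorem tendsto_ofReal_exp_neg_inv_pow {T : ℝ} (hT : 0 < T) :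
    Tendsto (fun n : ℕ => ENNReal.ofReal (Real.exp (-1 / T)) ^ n) atTop (nhds 0) := by
  refine ENNReal.tendsto_pow_atTop_nhds_zero_of_lt_one ?_
  rw [ENNReal.ofReal_lt_one, Real.exp_lt_one_iff]
  exact div_neg_of_neg_of_pos (by norm_num) hT

section Bounds

variable {φ : 𝒜 → 𝒳 → ℝ≥0} {α : ℝ≥0} {π : Measure 𝒳} [IsProbabilityMeasure π]
  {P : Measure (ℕ → 𝒳)} {T η : ℝ}

theorem lintegral_expReward_mkvRejTime_le (hφ : Measurable fun p : 𝒜 × 𝒳 => φ p.1 p.2)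
    (hP : IsIIDProduct π P) (hα : 0 < α) (hα1 : 1 < α⁻¹) (hT : 0 < T) (hη : 0 ≤ η)
    (hd : ∀ b, ENNReal.ofReal (Real.exp (-1 / T)) * ∫⁻ z, (φ b z : ℝ≥0∞) ^ η ∂π ≤ 1)
    {a : (n : ℕ) → (Set.Ico (0 : ℝ≥0) α⁻¹) → 𝒜} (ha : ∀ n, Measurable (a n)) :
    ∫⁻ x, expReward T (mkvRejTime φ α a x) ∂P ≤ (α : ℝ≥0∞) ^ η := by
  have := hP.1
  set d := ENNReal.ofReal (Real.exp (-1 / T))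
  have hα_top : (α : ℝ≥0∞) ^ η ≠ ⊤ := ENNReal.rpow_ne_top_of_nonneg hη ENNReal.coe_ne_top
  have hbound : ∀ n, ∫⁻ x, expReward T (mkvRejTime φ α a x) ∂P ≤ (α : ℝ≥0∞) ^ η + d ^ n := by
    intro n
    calc ∫⁻ x, expReward T (mkvRejTime φ α a x) ∂P
        ≤ ∫⁻ x, ((α : ℝ≥0∞) ^ η *
            (mkvDiscount φ α a d n x * (mkvWealth φ α a n x : ℝ≥0∞) ^ η) + d ^ n) ∂P := by
          refine lintegral_mono fun x => ?_
          rcases mkvWealth_dichotomy (φ := φ) (a := a) hα1 d x n with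
            ⟨hlt, -⟩ | ⟨hge, k, hk, hdisc⟩
          · refine le_add_left (expReward_le_pow hT (le_iInf₂ fun t ht => Nat.cast_le.2 ?_))
            by_contra! hcon
            exact (hlt t hcon.le).not_ge ht.2
          · refine le_add_right ?_
            rw [hk, expReward_natCast, hdisc, mul_left_comm,
              ← ENNReal.mul_rpow_of_nonneg _ _ hη]
            refine le_mul_of_one_le_right' ?_
            rw [← ENNReal.one_rpow η]
            refine ENNReal.rpow_le_rpow ?_ hη
            rw [← ENNReal.coe_mul, ENNReal.one_le_coe_iff]
            calc 1 = α * α⁻¹ := (mul_inv_cancel₀ hα.ne').symm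
              _ ≤ _ := by gcongr
      _ = (α : ℝ≥0∞) ^ η *
            ∫⁻ x, mkvDiscount φ α a d n x * (mkvWealth φ α a n x : ℝ≥0∞) ^ η ∂P + d ^ n := by
          rw [lintegral_add_right _ measurable_const, lintegral_const_mul' _ _ hα_top]
          simp
      _ ≤ (α : ℝ≥0∞) ^ η + d ^ n := by
          gcongr
          exact mul_le_of_le_one_right'
            (lintegral_mkvDiscount_mul_rpow_le_one hφ ha hP hη hd n)
  refine ge_of_tendsto' (x := atTop) ?_ hbound
  simpa using tendsto_const_nhds.add (tendsto_ofReal_exp_neg_inv_pow hT)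

theorem one_le_mul_lintegral_expReward_mkvRejTime_const
    (hφ : Measurable fun p : 𝒜 × 𝒳 => φ p.1 p.2)
    (hP : IsIIDProduct π P) (hα1 : 1 < α⁻¹) (hT : 0 < T) (hη : 0 ≤ η) {b : 𝒜}
    (hd : ENNReal.ofReal (Real.exp (-1 / T)) * ∫⁻ z, (φ b z : ℝ≥0∞) ^ η ∂π = 1)
    {Φ : ℝ≥0} (hΦ : ∀ᵐ z ∂π, φ b z ≤ Φ) :
    1 ≤ ((α⁻¹ * Φ : ℝ≥0) : ℝ≥0∞) ^ η *
      ∫⁻ x, expReward T (mkvRejTime φ α (fun _ _ => b) x) ∂P := by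
  have := hP.1
  set d := ENNReal.ofReal (Real.exp (-1 / T))
  have hΦ_all : ∀ᵐ x ∂P, ∀ n, φ b (x n) ≤ Φ := by
    refine ae_all_iff.2 fun n => ?_
    rw [← hP.map_eval n] at hΦ
    exact ae_of_ae_map (measurable_pi_apply n).aemeasurable hΦ
  have hpow_top : ∀ c : ℝ≥0, (c : ℝ≥0∞) ^ η ≠ ⊤ := fun c =>
    ENNReal.rpow_ne_top_of_nonneg hη ENNReal.coe_ne_top
  have hbound : ∀ n, 1 ≤ ((α⁻¹ * Φ : ℝ≥0) : ℝ≥0∞) ^ η *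
      ∫⁻ x, expReward T (mkvRejTime φ α (fun _ _ => b) x) ∂P +
        d ^ n * ((α⁻¹ : ℝ≥0) : ℝ≥0∞) ^ η := by
    intro n
    rw [← lintegral_const_mul' _ _ (hpow_top _)]
    calc 1 = ∫⁻ x, mkvDiscount φ α (fun _ _ => b) d n x *
          (mkvWealth φ α (fun _ _ => b) n x : ℝ≥0∞) ^ η ∂P :=
          (lintegral_mkvDiscount_mul_rpow_eq_one hφ hP hη hd n).symm
      _ ≤ ∫⁻ x, (((α⁻¹ * Φ : ℝ≥0) : ℝ≥0∞) ^ η *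
            expReward T (mkvRejTime φ α (fun _ _ => b) x) +
              d ^ n * ((α⁻¹ : ℝ≥0) : ℝ≥0∞) ^ η) ∂P := by
          refine lintegral_mono_ae ?_
          filter_upwards [hΦ_all] with x hx
          rcases mkvWealth_dichotomy (φ := φ) (a := fun _ _ => b) hα1 d x n with
            ⟨hlt, hdisc⟩ | ⟨hge, k, hk, hdisc⟩
          · refine le_add_left ?_
            rw [hdisc]
            gcongr
            exact (hlt n le_rfl).le
          · refine le_add_right ?_
            rw [hdisc, hk, expReward_natCast, mul_comm]
            gcongr
            exact mkvWealth_const_le hx n hα1 hge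
      _ = _ := by
          rw [lintegral_add_right _ measurable_const]
          simp
  refine ge_of_tendsto' (x := atTop) ?_ hbound
  simpa using tendsto_const_nhds.add
    (ENNReal.Tendsto.mul_const (tendsto_ofReal_exp_neg_inv_pow hT) (Or.inr (hpow_top α⁻¹)))

end Bounds

theorem edo_constant_policy_bounds
    (𝒳 𝒜 : Type*) [MeasurableSpace 𝒳] [StandardBorelSpace 𝒳]
    [MeasurableSpace 𝒜] [StandardBorelSpace 𝒜]
    (φ : 𝒜 → 𝒳 → ℝ≥0) (hφ : Measurable (fun p : 𝒜 × 𝒳 => φ p.1 p.2))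
    (π₁ : Measure 𝒳) [IsProbabilityMeasure π₁]
    (α : ℝ≥0) (hα : 0 < α) (hα1 : α < 1) (T : ℝ) (hT : 0 < T)
    (astar : 𝒜) (ηstar : ℝ) (hη : ηstar ∈ Set.Ioo (0 : ℝ) 1)
    (hsup : (⨆ a : 𝒜, ∫⁻ x, (φ a x : ℝ≥0∞) ^ ηstar ∂π₁)
      = ENNReal.ofReal (Real.exp (1 / T)))
    (hstar : (∫⁻ x, (φ astar x : ℝ≥0∞) ^ ηstar ∂π₁) = ENNReal.ofReal (Real.exp (1 / T)))
    (Φ : ℝ≥0) (hΦ : ∀ᵐ x ∂π₁, φ astar x ≤ Φ)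
    (P : Measure (ℕ → 𝒳)) (hP : IsIIDProduct π₁ P) :
    (((α / Φ) ^ ηstar : ℝ≥0) : ℝ≥0∞) ≤ ∫⁻ x, expReward T (constRejTime φ α astar x) ∂P ∧
    (∫⁻ x, expReward T (constRejTime φ α astar x) ∂P)
      ≤ (⨆ (a : (n : ℕ) → (Set.Ico (0 : ℝ≥0) α⁻¹) → 𝒜) (_ : ∀ n, Measurable (a n)),
          ∫⁻ x, expReward T (mkvRejTime φ α a x) ∂P) ∧
    (⨆ (a : (n : ℕ) → (Set.Ico (0 : ℝ≥0) α⁻¹) → 𝒜) (_ : ∀ n, Measurable (a n)),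
        ∫⁻ x, expReward T (mkvRejTime φ α a x) ∂P) ≤ ((α ^ ηstar : ℝ≥0) : ℝ≥0∞) := by
  have hα1' : 1 < α⁻¹ := (one_lt_inv₀ hα).2 hα1
  have hexp : ENNReal.ofReal (Real.exp (-1 / T)) * ENNReal.ofReal (Real.exp (1 / T)) = 1 := by
    rw [← ENNReal.ofReal_mul (Real.exp_pos _).le, ← Real.exp_add]
    simp [neg_div]
  have hconst : (∫⁻ x, expReward T (constRejTime φ α astar x) ∂P) =
      ∫⁻ x, expReward T (mkvRejTime φ α (fun _ _ => astar) x) ∂P :=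
    lintegral_congr fun x => by rw [mkvRejTime_const hα1' astar x]
  refine ⟨?_, ?_, ?_⟩
  · rw [hconst, ENNReal.coe_rpow_of_nonneg _ hη.1.le]
    have hlower := one_le_mul_lintegral_expReward_mkvRejTime_const hφ hP hα1' hT hη.1.le
      (hstar ▸ hexp) hΦ
    calc ((α / Φ : ℝ≥0) : ℝ≥0∞) ^ ηstar
        ≤ ((α / Φ : ℝ≥0) : ℝ≥0∞) ^ ηstar * (((α⁻¹ * Φ : ℝ≥0) : ℝ≥0∞) ^ ηstar *
            ∫⁻ x, expReward T (mkvRejTime φ α (fun _ _ => astar) x) ∂P) :=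
          le_mul_of_one_le_right' hlower
      _ ≤ _ := by
          rw [← mul_assoc, ← ENNReal.mul_rpow_of_nonneg _ _ hη.1.le, ← ENNReal.coe_mul]
          refine mul_le_of_le_one_left' (ENNReal.rpow_le_one ?_ hη.1.le)
          rw [ENNReal.coe_le_one_iff]
          calc α / Φ * (α⁻¹ * Φ) = (α * α⁻¹) * (Φ / Φ) := by ring
            _ ≤ 1 := by
              rw [mul_inv_cancel₀ hα.ne', one_mul]
              exact div_self_le_one Φ
  · rw [hconst]
    exact le_iSup₂_of_le (fun _ _ => astar) (fun _ => measurable_const) le_rfl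
  · rw [ENNReal.coe_rpow_of_nonneg _ hη.1.le]
    refine iSup₂_le fun a ha => lintegral_expReward_mkvRejTime_le hφ hP hα hα1' hT hη.1.le
      (fun b => ?_) ha
    rw [← hexp, ← hsup]
    gcongr
    exact le_iSup (fun a : 𝒜 => ∫⁻ x, (φ a x : ℝ≥0∞) ^ ηstar ∂π₁) b

end
end

section
/- Let η ∈ (0,1), π₁ ≪ π₀ with L = dπ₁/dπ₀, and suppose 𝔼_{π₀}[L^{1/(1-η)}] < ∞. Then sup over probability measures π ≪ π₀ of 𝔼_{π₁}[(dπ/dπ₀)^η] equals 𝔼_{π₀}[L^{1/(1-η)}]^{1-η}, and the supremum is attained by the tilted measure π_η defined by dπ_η/dπ₀ = L^{1/(1-η)}/𝔼_{π₀}[L^{1/(1-η)}]. -/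
open MeasureTheory ProbabilityTheory ENNReal NNReal Set Filter

attribute [local instance] Classical.propDecidable

noncomputable section

/-- Hölder upper bound for `𝔼_ν[(dπ/dμ)^η]` over measures `π` of mass at most one. -/
theorem lintegral_rnDeriv_rpow_le {α : Type*} [MeasurableSpace α] {μ ν π : Measure α}
    [SigmaFinite μ] [SigmaFinite ν] (hνμ : ν ≪ μ) (hπ : π univ ≤ 1)
    {η : ℝ} (hη : η ∈ Set.Ioo (0 : ℝ) 1) :
    ∫⁻ x, (π.rnDeriv μ x) ^ η ∂ν
      ≤ (∫⁻ x, (ν.rnDeriv μ x) ^ (1 / (1 - η)) ∂μ) ^ (1 - η) := by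
  obtain ⟨h0, h1⟩ := hη
  have h1' : 0 < 1 - η := by linarith
  have hpq : (1 / (1 - η)).HolderConjugate (1 / η) := by
    rw [Real.holderConjugate_iff]
    refine ⟨by rw [lt_div_iff₀ h1']; linarith, by simp⟩
  have hmπ : AEMeasurable (fun x => (π.rnDeriv μ x) ^ η) μ :=
    ((Measure.measurable_rnDeriv π μ).pow_const η).aemeasurable
  have hpow : ∀ x, ((π.rnDeriv μ x) ^ η) ^ (1 / η) = π.rnDeriv μ x := fun x => by
    rw [← ENNReal.rpow_mul, mul_one_div_cancel h0.ne', ENNReal.rpow_one]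
  have hmass : ∫⁻ x, π.rnDeriv μ x ∂μ ≤ 1 := (Measure.lintegral_rnDeriv_le).trans hπ
  rw [← lintegral_rnDeriv_mul hνμ hmπ]
  refine (ENNReal.lintegral_mul_le_Lp_mul_Lq μ hpq
    (Measure.measurable_rnDeriv ν μ).aemeasurable hmπ).trans ?_
  simp only [hpow, one_div_one_div]
  exact mul_le_of_le_one_right' (ENNReal.rpow_le_one hmass h0.le)

/-- The normalizing constant of the tilted measure does not vanish. -/
theorem lintegral_rnDeriv_rpow_ne_zero {α : Type*} [MeasurableSpace α] {μ ν : Measure α}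
    [SigmaFinite μ] [SigmaFinite ν] (hνμ : ν ≪ μ) (hν : ν ≠ 0) {p : ℝ} (hp : 0 < p) :
    ∫⁻ x, (ν.rnDeriv μ x) ^ p ∂μ ≠ 0 := by
  intro h
  rw [lintegral_eq_zero_iff ((Measure.measurable_rnDeriv ν μ).pow_const p)] at h
  have hL : ν.rnDeriv μ =ᵐ[μ] 0 := by
    filter_upwards [h] with x hx
    simpa [ENNReal.rpow_eq_zero_iff_of_pos hp] using hx
  apply hν
  rw [← Measure.withDensity_rnDeriv_eq ν μ hνμ, withDensity_congr_ae hL, withDensity_zero]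

/-- The tilted measure attains the Hölder bound. -/
theorem lintegral_rnDeriv_tilted_rpow {α : Type*} [MeasurableSpace α] {μ ν : Measure α}
    [SigmaFinite μ] [SigmaFinite ν] (hνμ : ν ≪ μ) (hν : ν ≠ 0)
    {η : ℝ} (hη : η ∈ Set.Ioo (0 : ℝ) 1)
    (hfin : ∫⁻ x, (ν.rnDeriv μ x) ^ (1 / (1 - η)) ∂μ ≠ ⊤) :
    ∫⁻ x, ((μ.withDensity fun x => (ν.rnDeriv μ x) ^ (1 / (1 - η))
            / ∫⁻ y, (ν.rnDeriv μ y) ^ (1 / (1 - η)) ∂μ).rnDeriv μ x) ^ η ∂ν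
      = (∫⁻ x, (ν.rnDeriv μ x) ^ (1 / (1 - η)) ∂μ) ^ (1 - η) := by
  obtain ⟨h0, h1⟩ := hη
  have h1' : 0 < 1 - η := by linarith
  have hZ := lintegral_rnDeriv_rpow_ne_zero hνμ hν (one_div_pos.2 h1')
  have hexp : 1 / (1 - η) = 1 + 1 / (1 - η) * η := by field_simp; ring
  have hexp0 : 0 ≤ 1 / (1 - η) * η := by positivity
  set p := 1 / (1 - η)
  set Z := ∫⁻ x, (ν.rnDeriv μ x) ^ p ∂μ
  have hmp : Measurable fun x => (ν.rnDeriv μ x) ^ p :=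
    (Measure.measurable_rnDeriv ν μ).pow_const p
  have hd := Measure.rnDeriv_withDensity μ (hmp.div_const Z)
  have hmη : AEMeasurable (fun x => ((ν.rnDeriv μ x) ^ p / Z) ^ η) μ :=
    ((hmp.div_const Z).pow_const η).aemeasurable
  calc _ = ∫⁻ x, ((ν.rnDeriv μ x) ^ p / Z) ^ η ∂ν := by
        refine lintegral_congr_ae ?_
        filter_upwards [hνμ.ae_le hd] with x hx
        rw [hx]
    _ = ∫⁻ x, ν.rnDeriv μ x * ((ν.rnDeriv μ x) ^ p / Z) ^ η ∂μ :=
        (lintegral_rnDeriv_mul hνμ hmη).symm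
    _ = ∫⁻ x, (ν.rnDeriv μ x) ^ p * (Z ^ η)⁻¹ ∂μ := by
        refine lintegral_congr fun x => ?_
        rw [ENNReal.div_rpow_of_nonneg _ _ h0.le, div_eq_mul_inv, ← mul_assoc,
          ← ENNReal.rpow_mul]
        congr 1
        conv_rhs => rw [hexp, ENNReal.rpow_add_of_nonneg _ _ zero_le_one hexp0,
          ENNReal.rpow_one]
    _ = Z ^ (1 - η) := by
        rw [lintegral_mul_const _ hmp, ENNReal.rpow_sub _ _ hZ hfin, ENNReal.rpow_one,
          div_eq_mul_inv]

theorem tilted_measure_maximizes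
    (𝒳 : Type*) [MeasurableSpace 𝒳] [StandardBorelSpace 𝒳]
    (π₀ π₁ : Measure 𝒳) [IsProbabilityMeasure π₀] [IsProbabilityMeasure π₁]
    (hac : π₁ ≪ π₀) (η : ℝ) (hη : η ∈ Set.Ioo (0 : ℝ) 1)
    (hfin : (∫⁻ x, (π₁.rnDeriv π₀ x) ^ (1 / (1 - η)) ∂π₀) ≠ ⊤) :
    (⨆ (π : Measure 𝒳) (_ : IsProbabilityMeasure π) (_ : π ≪ π₀),
        ∫⁻ x, (π.rnDeriv π₀ x) ^ η ∂π₁)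
      = (∫⁻ x, (π₁.rnDeriv π₀ x) ^ (1 / (1 - η)) ∂π₀) ^ (1 - η) ∧
    ∃ πη : Measure 𝒳,
      πη = π₀.withDensity (fun x => (π₁.rnDeriv π₀ x) ^ (1 / (1 - η))
            / ∫⁻ y, (π₁.rnDeriv π₀ y) ^ (1 / (1 - η)) ∂π₀) ∧
      IsProbabilityMeasure πη ∧ πη ≪ π₀ ∧
      (∫⁻ x, (πη.rnDeriv π₀ x) ^ η ∂π₁)
        = (∫⁻ x, (π₁.rnDeriv π₀ x) ^ (1 / (1 - η)) ∂π₀) ^ (1 - η) := by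
  have hπ₁ : π₁ ≠ 0 := IsProbabilityMeasure.ne_zero π₁
  have hZ := lintegral_rnDeriv_rpow_ne_zero hac hπ₁ (one_div_pos.2 (sub_pos.2 hη.2))
  have hval := lintegral_rnDeriv_tilted_rpow hac hπ₁ hη hfin
  have hprob : IsProbabilityMeasure (π₀.withDensity fun x => (π₁.rnDeriv π₀ x) ^ (1 / (1 - η))
      / ∫⁻ y, (π₁.rnDeriv π₀ y) ^ (1 / (1 - η)) ∂π₀) := by
    refine ⟨?_⟩
    rw [withDensity_apply _ MeasurableSet.univ, Measure.restrict_univ]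
    simp_rw [div_eq_mul_inv _ (lintegral _ _)]
    rw [lintegral_mul_const _ ((Measure.measurable_rnDeriv π₁ π₀).pow_const _),
      ENNReal.mul_inv_cancel hZ hfin]
  have habs := withDensity_absolutelyContinuous π₀ fun x =>
    (π₁.rnDeriv π₀ x) ^ (1 / (1 - η)) / ∫⁻ y, (π₁.rnDeriv π₀ y) ^ (1 / (1 - η)) ∂π₀
  refine ⟨le_antisymm ?_ ?_, _, rfl, hprob, habs, hval⟩
  · exact iSup_le fun π => iSup_le fun hπ => iSup_le fun _ =>
      lintegral_rnDeriv_rpow_le hac prob_le_one hη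
  · exact hval.symm.le.trans (le_iSup_of_le _ (le_iSup_of_le hprob (le_iSup_of_le habs le_rfl)))

end
end

section
/- Fix a ∈ 𝒜 with φ(a,·) > 0 π₁-almost surely and γ(a) = 𝔼_{π₁}[log φ(a,·)] < 0. Suppose φ(a,·) ≤ Φ π₁-almost surely for some constant Φ and there exists κ > 0 with 𝔼_{π₁}[φ(a,·)^κ] = 1. Then for every starting wealth w ∈ (0, α^{-1}), the probability of eventual rejection satisfies (αw/Φ)^κ ≤ π₁^⊗(τ_w^a < ∞) ≤ (αw)^κ. -/
open MeasureTheory ProbabilityTheory ENNReal NNReal Set Filter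

attribute [local instance] Classical.propDecidable

noncomputable section

variable {𝒳 𝒜 : Type*} [MeasurableSpace 𝒳] [MeasurableSpace 𝒜]

/-- The measure described by `IsIIDProduct` is the infinite product measure of Mathlib. -/
lemma IsIIDProduct.eq_infinitePi {π : Measure 𝒳} [IsProbabilityMeasure π] {P : Measure (ℕ → 𝒳)}
    (hP : IsIIDProduct π P) : P = Measure.infinitePi (fun _ : ℕ => π) := by
  refine Measure.eq_infinitePi _ fun s t ht => ?_
  obtain ⟨n, hn⟩ : ∃ n, s ⊆ Finset.range n := s.exists_nat_subset_range
  have hset : Set.pi (s : Set ℕ) t = (fun (x : ℕ → 𝒳) (i : Fin n) => x i.val) ⁻¹'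
      Set.pi univ (fun i : Fin n => if i.val ∈ s then t i else univ) := by
    ext x
    simp only [Set.mem_pi, Finset.mem_coe, mem_preimage, mem_univ, true_imp_iff]
    constructor
    · intro h i
      split_ifs with hi
      · exact h i hi
      · trivial
    · intro h i hi
      simpa [hi] using h ⟨i, Finset.mem_range.1 (hn hi)⟩
  rw [hset, ← Measure.map_apply (by fun_prop), hP.2 n, Measure.pi_pi]
  · have hfac : ∀ i : Fin n, π (if i.val ∈ s then t i else univ)
        = (fun j : ℕ => if j ∈ s then π (t j) else 1) i := fun i => by
      split_ifs with hi <;> simp [hi]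
    rw [Finset.prod_congr rfl fun i _ => hfac i,
      Fin.prod_univ_eq_prod_range (fun j : ℕ => if j ∈ s then π (t j) else 1) n,
      Finset.prod_ite_mem, Finset.inter_eq_right.2 hn]
  · refine MeasurableSet.univ_pi fun i => ?_
    split_ifs
    · exact ht i
    · exact MeasurableSet.univ

/-- The σ-algebra on path space generated by the first `n` coordinates. -/
abbrev coordsBefore (𝒳 : Type*) [MeasurableSpace 𝒳] (n : ℕ) : MeasurableSpace (ℕ → 𝒳) :=
  ⨆ i ∈ Iio n, MeasurableSpace.comap (fun x : ℕ → 𝒳 => x i) inferInstance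

lemma coordsBefore_le (n : ℕ) : coordsBefore 𝒳 n ≤ MeasurableSpace.pi :=
  iSup₂_le fun i _ => (measurable_pi_apply i).comap_le

lemma measurable_apply_coordsBefore {i n : ℕ} (h : i < n) :
    Measurable[coordsBefore 𝒳 n] (fun x : ℕ → 𝒳 => x i) :=
  Measurable.mono (comap_measurable _)
    (le_iSup₂_of_le (f := fun i (_ : i ∈ Iio n) =>
      MeasurableSpace.comap (fun x : ℕ → 𝒳 => x i) inferInstance) i h le_rfl) le_rfl

/-- Coordinate `n` of an i.i.d. sequence is independent of the preceding coordinates. -/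
lemma IsIIDProduct.lintegral_mul_apply {π : Measure 𝒳} [IsProbabilityMeasure π]
    {P : Measure (ℕ → 𝒳)} (hP : IsIIDProduct π P) {n : ℕ} {F : (ℕ → 𝒳) → ℝ≥0∞}
    (hF : Measurable[coordsBefore 𝒳 n] F) {g : 𝒳 → ℝ≥0∞} (hg : Measurable g) :
    ∫⁻ x, F x * g (x n) ∂P = (∫⁻ x, F x ∂P) * ∫⁻ y, g y ∂π := by
  obtain rfl := hP.eq_infinitePi
  have hind : iIndepFun (fun (i : ℕ) (x : ℕ → 𝒳) => x i) (Measure.infinitePi fun _ => π) :=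
    iIndepFun_infinitePi (X := fun _ => id) fun _ => measurable_id
  have hdisj := indep_iSup_of_disjoint (fun i : ℕ => (measurable_pi_apply i).comap_le) hind
    (S := Iio n) (T := {n}) (by simp)
  rw [iSup_singleton] at hdisj
  refine (lintegral_mul_eq_lintegral_mul_lintegral_of_independent_measurableSpace
    (coordsBefore_le n) (measurable_pi_apply n).comap_le hdisj hF
    (hg.comp (comap_measurable _))).trans ?_
  congr 1
  exact (measurePreserving_eval_infinitePi (fun _ : ℕ => π) n).lintegral_comp hg

lemma measurable_constWealth {𝒜 : Type*} {φ : 𝒜 → 𝒳 → ℝ≥0} {a : 𝒜} (hφ : Measurable (φ a))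
    {t n : ℕ} (h : t ≤ n) : Measurable[coordsBefore 𝒳 n] (constWealth φ a t) := by
  induction t with
  | zero => exact measurable_const
  | succ t ih => exact (ih (by omega)).mul (hφ.comp (measurable_apply_coordsBefore h))

/-- Paths along which the wealth stays below `B` up to time `n`. -/
def belowUntil (φ : 𝒜 → 𝒳 → ℝ≥0) (a : 𝒜) (B : ℝ≥0) (n : ℕ) : Set (ℕ → 𝒳) :=
  {x | ∀ t ≤ n, constWealth φ a t x < B}

lemma belowUntil_antitone {𝒳 𝒜 : Type*} (φ : 𝒜 → 𝒳 → ℝ≥0) (a : 𝒜) (B : ℝ≥0) :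
    Antitone (belowUntil φ a B) :=
  fun _ _ hmn _ hx t ht => hx t (ht.trans hmn)

lemma measurableSet_belowUntil {𝒜 : Type*} {φ : 𝒜 → 𝒳 → ℝ≥0} {a : 𝒜} (hφ : Measurable (φ a))
    (B : ℝ≥0) (n : ℕ) : MeasurableSet[coordsBefore 𝒳 n] (belowUntil φ a B n) := by
  have : belowUntil φ a B n = ⋂ t : ℕ, ⋂ _ : t ≤ n, constWealth φ a t ⁻¹' Iio B := by
    ext; simp [belowUntil]
  rw [this]
  exact MeasurableSet.iInter fun t => MeasurableSet.iInter fun h =>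
    measurable_constWealth hφ h measurableSet_Iio

lemma le_constWealth_of_mem_diff {𝒳 𝒜 : Type*} {φ : 𝒜 → 𝒳 → ℝ≥0} {a : 𝒜} {B : ℝ≥0} {n : ℕ}
    {x : ℕ → 𝒳} (hx : x ∈ belowUntil φ a B n \ belowUntil φ a B (n + 1)) :
    B ≤ constWealth φ a (n + 1) x := by
  by_contra! h
  refine hx.2 fun t ht => ?_
  rcases Nat.le_succ_iff.1 ht with ht | rfl
  · exact hx.1 t ht
  · exact h

lemma belowUntil_zero {𝒳 𝒜 : Type*} {φ : 𝒜 → 𝒳 → ℝ≥0} {a : 𝒜} {B : ℝ≥0} (hB : 1 < B) :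
    belowUntil φ a B 0 = univ := by
  ext x
  simp [belowUntil, constWealth, hB]

section Bounds

variable {𝒜 : Type*} {φ : 𝒜 → 𝒳 → ℝ≥0} {a : 𝒜} {π : Measure 𝒳} [IsProbabilityMeasure π]
  {P : Measure (ℕ → 𝒳)} {κ : ℝ}

lemma lintegral_constWealth_rpow (hP : IsIIDProduct π P) (hφ : Measurable (φ a)) (hκ : 0 ≤ κ)
    (n : ℕ) :
    ∫⁻ x, (constWealth φ a n x : ℝ≥0∞) ^ κ ∂P = (∫⁻ y, (φ a y : ℝ≥0∞) ^ κ ∂π) ^ n := by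
  have := hP.1
  induction n with
  | zero => simp [constWealth]
  | succ n ih =>
    simp only [constWealth, ENNReal.coe_mul, ENNReal.mul_rpow_of_nonneg _ _ hκ]
    rw [hP.lintegral_mul_apply
      ((measurable_constWealth hφ le_rfl).coe_nnreal_ennreal.pow_const κ)
      (hφ.coe_nnreal_ennreal.pow_const κ), ih, pow_succ]

/-- One step of the martingale `constWealth ^ κ` stopped at the level `B`. -/
lemma setLIntegral_belowUntil_succ (hP : IsIIDProduct π P) (hφ : Measurable (φ a)) (hκ : 0 ≤ κ)
    (hκ1 : ∫⁻ y, (φ a y : ℝ≥0∞) ^ κ ∂π = 1) (B : ℝ≥0) (n : ℕ) :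
    ∫⁻ x in belowUntil φ a B (n + 1), (constWealth φ a (n + 1) x : ℝ≥0∞) ^ κ ∂P
      + ∫⁻ x in belowUntil φ a B n \ belowUntil φ a B (n + 1),
          (constWealth φ a (n + 1) x : ℝ≥0∞) ^ κ ∂P
      = ∫⁻ x in belowUntil φ a B n, (constWealth φ a n x : ℝ≥0∞) ^ κ ∂P := by
  have hmeas (m : ℕ) := coordsBefore_le m _ (measurableSet_belowUntil hφ B m)
  have hsplit := lintegral_inter_add_sdiff (μ := P)
    (fun x => (constWealth φ a (n + 1) x : ℝ≥0∞) ^ κ) (belowUntil φ a B n) (hmeas (n + 1))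
  rw [inter_eq_right.2 (belowUntil_antitone φ a B n.le_succ)] at hsplit
  rw [hsplit, ← lintegral_indicator (hmeas n), ← lintegral_indicator (hmeas n)]
  have hfac : ∀ x, (belowUntil φ a B n).indicator
        (fun x => (constWealth φ a (n + 1) x : ℝ≥0∞) ^ κ) x
      = (belowUntil φ a B n).indicator (fun x => (constWealth φ a n x : ℝ≥0∞) ^ κ) x
        * (φ a (x n) : ℝ≥0∞) ^ κ := fun x => by
    by_cases hx : x ∈ belowUntil φ a B n <;>
      simp [hx, constWealth, ENNReal.mul_rpow_of_nonneg _ _ hκ]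
  rw [lintegral_congr hfac, hP.lintegral_mul_apply (Measurable.indicator
    ((measurable_constWealth hφ le_rfl).coe_nnreal_ennreal.pow_const κ)
    (measurableSet_belowUntil hφ B n)) (hφ.coe_nnreal_ennreal.pow_const κ), hκ1, mul_one]

lemma measure_compl_belowUntil_succ (hφ : Measurable (φ a)) (B : ℝ≥0) (n : ℕ) :
    P (belowUntil φ a B (n + 1))ᶜ = P (belowUntil φ a B n)ᶜ
      + P (belowUntil φ a B n \ belowUntil φ a B (n + 1)) := by
  have hmeas (m : ℕ) := coordsBefore_le m _ (measurableSet_belowUntil hφ B m)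
  rw [← measure_union _ ((hmeas n).diff (hmeas (n + 1)))]
  · congr 1
    ext x
    have hsub : x ∈ belowUntil φ a B (n + 1) → x ∈ belowUntil φ a B n :=
      fun hx => belowUntil_antitone φ a B n.le_succ hx
    simp only [mem_compl_iff, mem_union, Set.mem_sdiff]
    tauto
  · exact disjoint_left.2 fun x hx hx' => hx hx'.1

lemma setLIntegral_add_measure_le_one (hP : IsIIDProduct π P) (hφ : Measurable (φ a))
    (hκ : 0 ≤ κ) (hκ1 : ∫⁻ y, (φ a y : ℝ≥0∞) ^ κ ∂π = 1) {B : ℝ≥0} (hB : 1 < B) (n : ℕ) :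
    ∫⁻ x in belowUntil φ a B n, (constWealth φ a n x : ℝ≥0∞) ^ κ ∂P
      + (B : ℝ≥0∞) ^ κ * P (belowUntil φ a B n)ᶜ ≤ 1 := by
  have := hP.1
  have hmeas (m : ℕ) := coordsBefore_le m _ (measurableSet_belowUntil hφ B m)
  induction n with
  | zero => simp [belowUntil_zero hB, constWealth]
  | succ n ih =>
    refine le_trans ?_ ih
    rw [← setLIntegral_belowUntil_succ hP hφ hκ hκ1 B n, measure_compl_belowUntil_succ hφ, mul_add,
      add_assoc, add_comm (_ * P (belowUntil φ a B n)ᶜ)]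
    refine add_le_add le_rfl (add_le_add ?_ le_rfl)
    rw [← setLIntegral_const]
    refine setLIntegral_mono' ((hmeas n).diff (hmeas (n + 1))) fun x hx => ?_
    gcongr
    exact le_constWealth_of_mem_diff hx

lemma one_le_setLIntegral_add_measure (hP : IsIIDProduct π P) (hφ : Measurable (φ a))
    (hκ : 0 ≤ κ) (hκ1 : ∫⁻ y, (φ a y : ℝ≥0∞) ^ κ ∂π = 1) {Φ : ℝ≥0} (hΦ : ∀ᵐ y ∂π, φ a y ≤ Φ)
    {B : ℝ≥0} (hB : 1 < B) (n : ℕ) :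
    1 ≤ ∫⁻ x in belowUntil φ a B n, (constWealth φ a n x : ℝ≥0∞) ^ κ ∂P
      + ((B * Φ : ℝ≥0) : ℝ≥0∞) ^ κ * P (belowUntil φ a B n)ᶜ := by
  have := hP.1
  have hmeas (m : ℕ) := coordsBefore_le m _ (measurableSet_belowUntil hφ B m)
  induction n with
  | zero => simp [belowUntil_zero hB, constWealth]
  | succ n ih =>
    refine le_trans ih ?_
    rw [← setLIntegral_belowUntil_succ hP hφ hκ hκ1 B n, measure_compl_belowUntil_succ hφ, mul_add,
      add_assoc, add_comm (_ * P (belowUntil φ a B n)ᶜ)]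
    refine add_le_add le_rfl (add_le_add ?_ le_rfl)
    rw [← setLIntegral_const]
    have hΦn : ∀ᵐ x ∂P, φ a (x n) ≤ Φ := by
      obtain rfl := hP.eq_infinitePi
      exact (measurePreserving_eval_infinitePi
        (fun _ : ℕ => π) n).quasiMeasurePreserving.ae hΦ
    refine setLIntegral_mono_ae' ((hmeas n).diff (hmeas (n + 1))) ?_
    filter_upwards [hΦn] with x hxΦ hx
    gcongr
    exact mul_le_mul' (hx.1 n le_rfl).le hxΦ

/-- A nondegenerate factor with unit `κ`-th moment has `κ / 2`-th moment less than one. -/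
lemma lintegral_rpow_half_lt_one (hφ : Measurable (φ a)) (hκ : 0 < κ)
    (hκ1 : ∫⁻ y, (φ a y : ℝ≥0∞) ^ κ ∂π = 1) (hne : ¬ ∀ᵐ y ∂π, φ a y = 1) :
    ∫⁻ y, (φ a y : ℝ≥0∞) ^ (κ / 2) ∂π < 1 := by
  by_contra! hge
  have hsq : ∀ y, ((φ a y : ℝ≥0∞)) ^ κ = ((φ a y ^ (κ / 2) : ℝ≥0) : ℝ≥0∞) ^ 2 := fun y => by
    rw [ENNReal.coe_rpow_of_nonneg _ (by positivity), ← ENNReal.rpow_natCast,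
      ← ENNReal.rpow_mul]
    norm_num
  have hhalf : ∀ y, ((φ a y : ℝ≥0∞)) ^ (κ / 2) = ((φ a y ^ (κ / 2) : ℝ≥0) : ℝ≥0∞) := fun y => by
    rw [ENNReal.coe_rpow_of_nonneg _ (by positivity)]
  have hle : ∀ y, 2 * (φ a y : ℝ≥0∞) ^ (κ / 2) ≤ 1 + (φ a y : ℝ≥0∞) ^ κ := fun y => by
    rw [hsq, hhalf]
    norm_cast
    rw [← NNReal.coe_le_coe]
    push_cast
    nlinarith [sq_nonneg ((φ a y : ℝ) ^ (κ / 2) - 1)]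
  have hint : ∫⁻ y, (1 + (φ a y : ℝ≥0∞) ^ κ) ∂π = 2 := by
    rw [lintegral_add_left measurable_const, hκ1]
    simp [one_add_one_eq_two]
  have heq := ae_eq_of_ae_le_of_lintegral_le (μ := π) (ae_of_all _ hle)
    (ne_top_of_le_ne_top (by simp) ((lintegral_mono hle).trans_eq hint))
    (measurable_const.add (hφ.coe_nnreal_ennreal.pow_const κ)).aemeasurable (by
      rw [hint, lintegral_const_mul _ (hφ.coe_nnreal_ennreal.pow_const _)]
      simpa using mul_le_mul_right hge 2)
  refine hne ?_
  filter_upwards [heq] with y hy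
  rw [hsq, hhalf] at hy
  norm_cast at hy
  have hy' : 2 * ((φ a y ^ (κ / 2) : ℝ≥0) : ℝ) = 1 + ((φ a y ^ (κ / 2) : ℝ≥0) : ℝ) ^ 2 := by
    exact_mod_cast hy
  have hone : φ a y ^ (κ / 2) = 1 := by
    rw [← NNReal.coe_inj, NNReal.coe_one]
    nlinarith [sq_nonneg (((φ a y ^ (κ / 2) : ℝ≥0) : ℝ) - 1)]
  exact NNReal.rpow_left_injective (by positivity : κ / 2 ≠ 0)
    (hone.trans (NNReal.one_rpow _).symm)

lemma tendsto_setLIntegral_belowUntil (hP : IsIIDProduct π P) (hφ : Measurable (φ a))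
    (hκ : 0 < κ) (hκ1 : ∫⁻ y, (φ a y : ℝ≥0∞) ^ κ ∂π = 1) (hne : ¬ ∀ᵐ y ∂π, φ a y = 1)
    (B : ℝ≥0) :
    Tendsto (fun n => ∫⁻ x in belowUntil φ a B n, (constWealth φ a n x : ℝ≥0∞) ^ κ ∂P)
      atTop (nhds 0) := by
  have hmeas (m : ℕ) := coordsBefore_le m _ (measurableSet_belowUntil hφ B m)
  have hbound : ∀ n, ∫⁻ x in belowUntil φ a B n, (constWealth φ a n x : ℝ≥0∞) ^ κ ∂P
      ≤ (B : ℝ≥0∞) ^ (κ / 2) * (∫⁻ y, (φ a y : ℝ≥0∞) ^ (κ / 2) ∂π) ^ n := fun n => by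
    rw [← lintegral_constWealth_rpow hP hφ (by positivity) n, ← lintegral_const_mul _
      (((measurable_constWealth hφ le_rfl).mono (coordsBefore_le n)
        le_rfl).coe_nnreal_ennreal.pow_const _)]
    refine le_trans (setLIntegral_mono' (hmeas n) fun x hx => ?_) (setLIntegral_le_lintegral _ _)
    rw [← add_halves κ, ENNReal.rpow_add_of_nonneg _ _ (by positivity) (by positivity),
      add_halves]
    gcongr
    exact (hx n le_rfl).le
  refine tendsto_of_tendsto_of_tendsto_of_le_of_le tendsto_const_nhds ?_ (fun _ => zero_le) hbound
  rw [← mul_zero ((B : ℝ≥0∞) ^ (κ / 2))]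
  exact ENNReal.Tendsto.const_mul (ENNReal.tendsto_pow_atTop_nhds_zero_of_lt_one
    (lintegral_rpow_half_lt_one hφ hκ hκ1 hne)) (Or.inr
      (ENNReal.rpow_ne_top_of_nonneg (by positivity) ENNReal.coe_ne_top))

end Bounds

theorem power_bounds_negative_drift
    (𝒳 𝒜 : Type*) [MeasurableSpace 𝒳] [StandardBorelSpace 𝒳]
    [MeasurableSpace 𝒜] [StandardBorelSpace 𝒜]
    (φ : 𝒜 → 𝒳 → ℝ≥0) (hφ : Measurable (fun p : 𝒜 × 𝒳 => φ p.1 p.2))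
    (π₁ : Measure 𝒳) [IsProbabilityMeasure π₁]
    (α : ℝ≥0) (hα : 0 < α) (hα1 : α < 1)
    (a : 𝒜) (hpos : ∀ᵐ x ∂π₁, 0 < φ a x)
    -- `γ(a) = 𝔼_{π₁}[log φ(a,·)] < 0`: the positive part of `log φ(a,·)` has strictly
    -- smaller integral than the negative part.
    (hγ : (∫⁻ x, ENNReal.ofReal (Real.log (φ a x)) ∂π₁)
            < (∫⁻ x, ENNReal.ofReal (-Real.log (φ a x)) ∂π₁))
    (Φ : ℝ≥0) (hΦ : ∀ᵐ x ∂π₁, φ a x ≤ Φ)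
    (κ : ℝ) (hκ : 0 < κ) (hκ1 : (∫⁻ x, (φ a x : ℝ≥0∞) ^ κ ∂π₁) = 1)
    (P : Measure (ℕ → 𝒳)) (hP : IsIIDProduct π₁ P) :
    ∀ w : ℝ≥0, 0 < w → w < α⁻¹ →
      (((α * w / Φ) ^ κ : ℝ≥0) : ℝ≥0∞)
          ≤ P {x | ∃ t : ℕ, 1 ≤ t ∧ α⁻¹ ≤ w * constWealth φ a t x} ∧
      P {x | ∃ t : ℕ, 1 ≤ t ∧ α⁻¹ ≤ w * constWealth φ a t x}
          ≤ (((α * w) ^ κ : ℝ≥0) : ℝ≥0∞) := by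
  intro w hw hwα
  have hφa : Measurable (φ a) := hφ.comp measurable_prodMk_left
  have := hP.1
  set B : ℝ≥0 := α⁻¹ / w with hBdef
  have hB : 1 < B := (one_lt_div hw).2 hwα
  have hBinv : α * w = B⁻¹ := by
    rw [hBdef]; field_simp
  have hBpos : 0 < B := zero_lt_one.trans hB
  have hevent : {x | ∃ t : ℕ, 1 ≤ t ∧ α⁻¹ ≤ w * constWealth φ a t x}
      = ⋃ n, (belowUntil φ a B n)ᶜ := by
    ext x
    simp only [mem_ofPred_eq, mem_iUnion, mem_compl_iff, belowUntil, not_forall, not_lt,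
      exists_prop, hBdef, div_le_iff₀' hw]
    constructor
    · rintro ⟨t, -, ht⟩
      exact ⟨t, t, le_rfl, ht⟩
    · rintro ⟨-, t, -, ht⟩
      refine ⟨t, Nat.one_le_iff_ne_zero.2 ?_, ht⟩
      rintro rfl
      exact absurd ht (by simpa [constWealth] using hwα)
  have hne : ¬ ∀ᵐ y ∂π₁, φ a y = 1 := fun h => by
    have hzero : ∀ᵐ y ∂π₁, Real.log (φ a y) = 0 := h.mono fun y hy => by simp [hy]
    refine hγ.ne (lintegral_congr_ae ?_)
    filter_upwards [hzero] with y hy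
    rw [hy, neg_zero]
  have hΦpos : 0 < Φ := by
    obtain ⟨y, hy, hyΦ⟩ := (hpos.and hΦ).exists
    exact hy.trans_le hyΦ
  rw [hevent]
  constructor
  · have hlim := (tendsto_setLIntegral_belowUntil hP hφa hκ hκ1 hne B).add_const
      (((B * Φ : ℝ≥0) : ℝ≥0∞) ^ κ * P (⋃ n, (belowUntil φ a B n)ᶜ))
    rw [zero_add] at hlim
    have hone := ge_of_tendsto' hlim fun n =>
      (one_le_setLIntegral_add_measure hP hφa hκ.le hκ1 hΦ hB n).trans <| by
        gcongr
        exact subset_iUnion (fun n => (belowUntil φ a B n)ᶜ) n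
    have hinv : α * w / Φ = (B * Φ)⁻¹ := by
      rw [hBinv, mul_inv, div_eq_mul_inv]
    rw [hinv, ENNReal.coe_rpow_of_nonneg _ hκ.le, ENNReal.coe_inv (by positivity),
      ENNReal.inv_rpow, ENNReal.inv_le_iff_le_mul
        (fun _ => (ENNReal.rpow_pos (by positivity) ENNReal.coe_ne_top).ne')
        (fun h => absurd h (ENNReal.rpow_ne_top_of_nonneg hκ.le ENNReal.coe_ne_top))]
    exact hone
  · rw [(monotone_nat_of_le_succ fun n => compl_subset_compl.2
      (belowUntil_antitone φ a B n.le_succ)).measure_iUnion]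
    refine iSup_le fun n => ?_
    rw [hBinv, ENNReal.coe_rpow_of_nonneg _ hκ.le, ENNReal.coe_inv hBpos.ne', ENNReal.inv_rpow,
      ENNReal.le_inv_iff_mul_le, mul_comm]
    exact le_add_self.trans (setLIntegral_add_measure_le_one hP hφa hκ.le hκ1 hB n)

end
end
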